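/- Let α ≥ 0 and let σ₁ ≤ σ₂ ≤ … ≤ σ_{n+1} be real numbers. Suppose u₁,…,u_n : ℝⁿ → ℝⁿ are smooth maps that vanish on ∂Ω, are orthonormal in L²(Ω, dm) (∫_Ω ⟨uᵢ, uⱼ⟩ dm = 1 if i = j and 0 otherwise), and satisfy 𝓛uᵢ + α∇(div_η uᵢ) = −σᵢ uᵢ at every point of Ω. Suppose moreover that for each i = 1,…,n, σ_{i+1} has the min–max property: for every smooth w : ℝⁿ → ℝⁿ vanishing on ∂Ω with ∫_Ω ⟨w, uⱼ⟩ dm = 0 for j = 1,…,i, one has σ_{i+1} ∫_Ω |w|² dm ≤ ∫_Ω (⟨T(∇w), ∇w⟩ + α (div_η w)²) dm. Then Σ_{i=1}^n (σ_{i+1} − σ₁) ≤ (4δ(δ + α)/ε²) · ( σ₁ − α‖div_η u₁‖² + (T₀² + 4C₀)/(4δ) ). -/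

import Mathlib

open MeasureTheory Real
open scoped RealInnerProductSpace BigOperators

noncomputable section

abbrev En (n : ℕ) := EuclideanSpace ℝ (Fin n)

/-- Divergence of a vector field on Euclidean space: trace of the derivative. -/
def vdiv {n : ℕ} (X : En n → En n) (x : En n) : ℝ :=
  ∑ i, fderiv ℝ X x (EuclideanSpace.single i 1) i

/-- Weighted divergence `div_η X = div X − ⟨∇η, X⟩`. -/
def vdivEta {n : ℕ} (η : En n → ℝ) (X : En n → En n) (x : En n) : ℝ :=
  vdiv X x - ⟪gradient η x, X x⟫

/-- The operator `𝓛 f = div_η (T (∇ f))`. -/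
def Lop {n : ℕ} (T : En n → (En n →L[ℝ] En n)) (η : En n → ℝ) (f : En n → ℝ) (x : En n) : ℝ :=
  vdivEta η (fun y => T y (gradient f y)) x

/-- The vector field `tr(∇T)(x) = ∑ i (D_{e i} T)(x)(e i)`. -/
def trGradT {n : ℕ} (T : En n → (En n →L[ℝ] En n)) (x : En n) : En n :=
  ∑ i, fderiv ℝ T x (EuclideanSpace.single i 1) (EuclideanSpace.single i 1)

/-- Lebesgue measure on `Ω`, weighted with density `e^{-η}`. -/
def wMeasure {n : ℕ} (η : En n → ℝ) (Ω : Set (En n)) : Measure (En n) :=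
  (volume.restrict Ω).withDensity fun x => ENNReal.ofReal (Real.exp (-η x))

lemma countable_setOf_zero_deriv_ne_zero (f : ℝ → ℝ) :
    {t | f t = 0 ∧ deriv f t ≠ 0}.Countable := by
  refine (countable_setOfPred_isolated_right_within (s := {t | f t = 0})).mono ?_
  rintro t ⟨h0, h1⟩
  refine ⟨h0, ?_⟩
  have hd : HasDerivAt f (deriv f t) t :=
    (differentiableAt_of_deriv_ne_zero h1).hasDerivAt
  have h2 := hd.eventually_ne (c := 0) h1
  rw [← Filter.empty_mem_iff_bot]
  have h3 : ∀ᶠ z in nhdsWithin t ({t | f t = 0} ∩ Set.Ioi t), f z ≠ 0 :=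
    h2.filter_mono (nhdsWithin_mono _ fun z hz => ne_of_gt hz.2)
  filter_upwards [h3, self_mem_nhdsWithin] with z hz hz'
  exact hz hz'.1

section ZeroExtension

variable {E : Type*} [NormedAddCommGroup E] [NormedSpace ℝ E] {Ω : Set E} {h : E → ℝ}

lemma exists_mem_segment_frontier {x y : E} (hx : x ∈ Ω) (hy : y ∉ Ω) (hΩ : IsOpen Ω) :
    ∃ z ∈ segment ℝ x y, z ∈ frontier Ω := by
  by_contra! hcon
  have hcov : segment ℝ x y ⊆ Ω ∪ (closure Ω)ᶜ := by
    intro z hz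
    by_cases hzΩ : z ∈ Ω
    · exact Or.inl hzΩ
    · refine Or.inr fun hzc => hcon z hz ?_
      rw [hΩ.frontier_eq]
      exact ⟨hzc, hzΩ⟩
  have hyc : y ∈ (closure Ω)ᶜ := (hcov (right_mem_segment ℝ x y)).resolve_left hy
  obtain ⟨z, -, hz1, hz2⟩ := (convex_segment x y).isPreconnected Ω _ hΩ
    isClosed_closure.isOpen_compl hcov ⟨x, left_mem_segment ℝ x y, hx⟩
    ⟨y, right_mem_segment ℝ x y, hyc⟩
  exact hz2 (subset_closure hz1)

lemma lipschitzWith_indicator_of_frontier_eq_zero {L : NNReal} (hΩ : IsOpen Ω)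
    (hL : LipschitzOnWith L h (closure Ω)) (h0 : ∀ x ∈ frontier Ω, h x = 0) :
    LipschitzWith L (Ω.indicator h) := by
  have key : ∀ x ∈ Ω, ∀ y ∉ Ω, |h x| ≤ L * dist x y := by
    intro x hx y hy
    obtain ⟨z, hz, hzf⟩ := exists_mem_segment_frontier hx hy hΩ
    have h1 := hL.dist_le_mul x (subset_closure hx) z (frontier_subset_closure hzf)
    rw [h0 z hzf, Real.dist_eq, sub_zero] at h1
    refine h1.trans (mul_le_mul_of_nonneg_left ?_ L.2)
    have := dist_add_dist_of_mem_segment hz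
    linarith [dist_nonneg (x := z) (y := y)]
  refine LipschitzWith.of_dist_le_mul fun x y => ?_
  by_cases hx : x ∈ Ω <;> by_cases hy : y ∈ Ω
  · rw [Set.indicator_of_mem hx, Set.indicator_of_mem hy]
    exact hL.dist_le_mul x (subset_closure hx) y (subset_closure hy)
  · rw [Set.indicator_of_mem hx, Set.indicator_of_notMem hy, Real.dist_eq, sub_zero]
    exact key x hx y hy
  · rw [Set.indicator_of_notMem hx, Set.indicator_of_mem hy, dist_comm, dist_comm x y,
      Real.dist_eq, sub_zero]
    exact key y hy x hx
  · rw [Set.indicator_of_notMem hx, Set.indicator_of_notMem hy, dist_self]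
    positivity

lemma hasLineDerivAt_indicator (hΩ : IsOpen Ω) (hh : Differentiable ℝ h)
    (h0 : ∀ x ∈ frontier Ω, h x = 0) (v x : E) (hx : h x = 0 → fderiv ℝ h x v = 0) :
    HasLineDerivAt ℝ (Ω.indicator h) (Ω.indicator (fun y => fderiv ℝ h y v) x) x v := by
  by_cases hxΩ : x ∈ Ω
  · rw [Set.indicator_of_mem hxΩ]
    refine ((hh x).hasFDerivAt.hasLineDerivAt v).congr_of_eventuallyEq ?_
    filter_upwards [hΩ.mem_nhds hxΩ] with y hy
    exact Set.indicator_of_mem hy h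
  rw [Set.indicator_of_notMem hxΩ]
  by_cases hxc : x ∈ closure Ω
  · have hx0 : h x = 0 := h0 x (by rw [hΩ.frontier_eq]; exact ⟨hxc, hxΩ⟩)
    have hd := (hh x).hasFDerivAt.hasLineDerivAt v
    rw [hx hx0] at hd
    rw [hasLineDerivAt_iff_isLittleO_nhds_zero] at hd ⊢
    refine Asymptotics.IsBigO.trans_isLittleO (Asymptotics.IsBigO.of_bound 1 ?_) hd
    refine Filter.Eventually.of_forall fun t => ?_
    rw [Set.indicator_of_notMem hxΩ, hx0]
    simp only [sub_zero, smul_zero, one_mul]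
    exact norm_indicator_le_norm_self h _
  · have : HasLineDerivAt ℝ (fun _ : E => (0 : ℝ)) 0 x v := by
      simpa using (hasFDerivAt_const (0 : ℝ) x).hasLineDerivAt v
    refine this.congr_of_eventuallyEq ?_
    filter_upwards [isClosed_closure.isOpen_compl.mem_nhds hxc] with y hy
    exact Set.indicator_of_notMem (fun hy' => hy (subset_closure hy')) h

variable [FiniteDimensional ℝ E] [MeasurableSpace E] [BorelSpace E]
  (μ : Measure E) [μ.IsAddHaarMeasure]

lemma ae_fderiv_eq_zero_of_eq_zero (hh : ContDiff ℝ 1 h) (v : E) :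
    ∀ᵐ x ∂μ, h x = 0 → fderiv ℝ h x v = 0 := by
  let L : ℝ →L[ℝ] E := ContinuousLinearMap.smulRight (1 : ℝ →L[ℝ] ℝ) v
  have hcont : Continuous fun x => fderiv ℝ h x v :=
    (hh.continuous_fderiv one_ne_zero).clm_apply continuous_const
  have hmeas : MeasurableSet {x | h x = 0 → fderiv ℝ h x v = 0} := by
    have : {x | h x = 0 → fderiv ℝ h x v = 0}
        = {x | h x = 0}ᶜ ∪ {x | fderiv ℝ h x v = 0} := by
      ext x; simp [imp_iff_not_or]
    rw [this]
    exact (isClosed_eq hh.continuous continuous_const).measurableSet.compl.union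
      (isClosed_eq hcont continuous_const).measurableSet
  refine ae_mem_of_ae_add_linearMap_mem L.toLinearMap volume μ hmeas fun p => ?_
  have hc := countable_setOf_zero_deriv_ne_zero fun t : ℝ => h (p + t • v)
  filter_upwards [hc.ae_notMem volume] with t ht h0
  by_contra hne
  refine ht ⟨by simpa [L] using h0, ?_⟩
  have hd : HasDerivAt (fun t : ℝ => h (p + t • v)) (fderiv ℝ h (p + t • v) v) t := by
    have h1 : HasDerivAt (fun t : ℝ => p + t • v) v t := by
      simpa using ((hasDerivAt_id t).smul_const v).const_add p
    exact ((hh.differentiable one_ne_zero) _).hasFDerivAt.comp_hasDerivAt t h1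
  rw [hd.deriv]
  simpa [L] using hne

/-- The integral of a directional derivative of a `C^1` function vanishing on the frontier of a
bounded open set is zero, without any regularity assumption on the frontier. -/
lemma setIntegral_fderiv_eq_zero_of_frontier_eq_zero (hΩ : IsOpen Ω)
    (hΩb : Bornology.IsBounded Ω) (hh : ContDiff ℝ 1 h) (h0 : ∀ x ∈ frontier Ω, h x = 0) (v : E) :
    ∫ x in Ω, fderiv ℝ h x v ∂μ = 0 := by
  have hK : IsCompact (closure Ω) := hΩb.isCompact_closure
  obtain ⟨L, hL⟩ :=
    (hh.locallyLipschitz.locallyLipschitzOn (s := closure Ω)).exists_lipschitzOnWith_of_compact hK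
  have hg := lipschitzWith_indicator_of_frontier_eq_zero hΩ hL h0
  have hcs : HasCompactSupport (Ω.indicator h) :=
    HasCompactSupport.intro hK fun x hx =>
      Set.indicator_of_notMem (fun hx' => hx (subset_closure hx')) h
  have key := LipschitzWith.integral_lineDeriv_mul_eq (μ := μ)
    (LipschitzWith.const (1 : ℝ)) hg hcs (-v)
  simp only [neg_neg, mul_one, lineDeriv, deriv_const, zero_mul, integral_zero] at key
  rw [← integral_indicator hΩ.measurableSet]
  refine Eq.trans ?_ key.symm
  refine integral_congr_ae ?_
  filter_upwards [ae_fderiv_eq_zero_of_eq_zero μ hh v] with x hx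
  exact ((hasLineDerivAt_indicator hΩ (hh.differentiable one_ne_zero) h0 v x hx).lineDeriv).symm

end ZeroExtension

section Calculus

variable {n : ℕ} {η f g : En n → ℝ} {X : En n → En n} {T : En n → (En n →L[ℝ] En n)}

lemma inner_eq_sum_mul (v w : En n) : ⟪v, w⟫ = ∑ i, v i * w i := by
  simp [PiLp.inner_apply, mul_comm]

lemma gradient_apply_eq_fderiv (f : En n → ℝ) (x : En n) (i : Fin n) :
    gradient f x i = fderiv ℝ f x (EuclideanSpace.single i 1) := by
  rw [← inner_gradient_left, EuclideanSpace.inner_single_right]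
  simp

lemma contDiff_gradient (hf : ContDiff ℝ (⊤ : ℕ∞) f) : ContDiff ℝ (⊤ : ℕ∞) (gradient f) :=
  ((InnerProductSpace.toDual ℝ (En n)).symm.contDiff).comp
    (hf.fderiv_right (m := (⊤ : ℕ∞)) (by simp))

lemma ContDiff.euclidean_apply (hX : ContDiff ℝ (⊤ : ℕ∞) X) (l : Fin n) :
    ContDiff ℝ (⊤ : ℕ∞) fun x => X x l :=
  contDiff_euclidean.1 hX l

lemma fderiv_euclidean_apply (hX : Differentiable ℝ X) (x v : En n) (l : Fin n) :
    fderiv ℝ (fun y => X y l) x v = fderiv ℝ X x v l := by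
  have h := ((EuclideanSpace.proj (𝕜 := ℝ) l).hasFDerivAt.comp x (hX x).hasFDerivAt).fderiv
  exact congrArg (fun φ => φ v) h

lemma contDiff_vdiv (hX : ContDiff ℝ (⊤ : ℕ∞) X) : ContDiff ℝ (⊤ : ℕ∞) (vdiv X) := by
  unfold vdiv
  refine ContDiff.sum fun i _ => ?_
  exact (((hX.fderiv_right (m := (⊤ : ℕ∞)) (by simp)).clm_apply contDiff_const)).euclidean_apply i

lemma contDiff_vdivEta (hη : ContDiff ℝ (⊤ : ℕ∞) η) (hX : ContDiff ℝ (⊤ : ℕ∞) X) :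
    ContDiff ℝ (⊤ : ℕ∞) (vdivEta η X) :=
  (contDiff_vdiv hX).sub ((contDiff_gradient hη).inner ℝ hX)

lemma contDiff_trGradT (hT : ContDiff ℝ (⊤ : ℕ∞) T) : ContDiff ℝ (⊤ : ℕ∞) (trGradT T) := by
  unfold trGradT
  refine ContDiff.sum fun i _ => ?_
  exact ((hT.fderiv_right (m := (⊤ : ℕ∞)) (by simp)).clm_apply contDiff_const).clm_apply
    contDiff_const

lemma gradient_mul (x : En n) (hf : DifferentiableAt ℝ f x) (hg : DifferentiableAt ℝ g x) :
    gradient (fun y => f y * g y) x = f x • gradient g x + g x • gradient f x := by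
  refine ext_inner_right ℝ fun v => ?_
  rw [inner_add_left, inner_smul_left, inner_smul_left, inner_gradient_left, inner_gradient_left,
    inner_gradient_left, fderiv_fun_mul hf hg]
  simp

lemma gradient_sum_mul_self (hX : Differentiable ℝ X) (x : En n) :
    gradient (fun y => ‖X y‖ ^ 2) x = (2 : ℝ) • ∑ l, X x l • gradient (fun y => X y l) x := by
  refine ext_inner_right ℝ fun v => ?_
  rw [inner_gradient_left, inner_smul_left, sum_inner,
    ((hX x).hasFDerivAt.norm_sq).fderiv]
  simp [inner_eq_sum_mul, inner_smul_left, inner_gradient_left, fderiv_euclidean_apply hX,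
    Finset.mul_sum]

lemma gradient_inner_sub_const (e : En n) (a : ℝ) (x : En n) :
    gradient (fun y => ⟪e, y⟫ - a) x = e := by
  refine ext_inner_right ℝ fun v => ?_
  rw [inner_gradient_left]
  have : HasFDerivAt (fun y : En n => ⟪e, y⟫ - a) (innerSL ℝ e) x :=
    ((innerSL ℝ e).hasFDerivAt).sub_const a
  rw [this.fderiv]
  simp

lemma vdiv_smul (x : En n) (hf : DifferentiableAt ℝ f x) (hX : DifferentiableAt ℝ X x) :
    vdiv (fun y => f y • X y) x = f x * vdiv X x + ⟪gradient f x, X x⟫ := by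
  unfold vdiv
  rw [inner_eq_sum_mul, Finset.mul_sum, ← Finset.sum_add_distrib, fderiv_fun_smul hf hX]
  refine Finset.sum_congr rfl fun i _ => ?_
  rw [gradient_apply_eq_fderiv]
  simp

lemma vdivEta_smul (x : En n) (hf : DifferentiableAt ℝ f x) (hX : DifferentiableAt ℝ X x) :
    vdivEta η (fun y => f y • X y) x = f x * vdivEta η X x + ⟪gradient f x, X x⟫ := by
  unfold vdivEta
  rw [vdiv_smul x hf hX, inner_smul_right]
  ring

lemma vdiv_neg (x : En n) : vdiv (fun y => -X y) x = -vdiv X x := by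
  simp [vdiv, fderiv_fun_neg]

/-- The divergence of `T` applied to a constant vector field. -/
lemma vdivEta_clm_apply_const (hT : Differentiable ℝ T)
    (hTsym : ∀ x v w, ⟪T x v, w⟫ = ⟪v, T x w⟫) (e x : En n) :
    vdivEta η (fun y => T y e) x = ⟪trGradT T x - T x (gradient η x), e⟫ := by
  have hda : ∀ v, HasFDerivAt (fun y => T y v) ((fderiv ℝ T x).flip v) x := fun v =>
    (ContinuousLinearMap.apply ℝ (En n) v).hasFDerivAt.comp x (hT x).hasFDerivAt
  have hd : ∀ z v, fderiv ℝ (fun y => T y v) x z = fderiv ℝ T x z v := fun z v => by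
    rw [(hda v).fderiv, ContinuousLinearMap.flip_apply]
  have hsym : ∀ z v w : En n, ⟪fderiv ℝ T x z v, w⟫ = ⟪v, fderiv ℝ T x z w⟫ := by
    intro z v w
    have h1 := fderiv_inner_apply ℝ (hda v).differentiableAt (differentiableAt_const w) z
    have h2 := fderiv_inner_apply ℝ (differentiableAt_const v) (hda w).differentiableAt z
    simp only [hTsym, hd] at h1 h2
    rw [h1] at h2
    simpa using h2
  unfold vdivEta vdiv trGradT
  rw [inner_sub_left, sum_inner, hTsym]
  congr 1
  refine Finset.sum_congr rfl fun i _ => ?_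
  rw [hd, hsym, EuclideanSpace.inner_single_left]
  simp

end Calculus

section WeightedMeasure

variable {n : ℕ} {η f : En n → ℝ} {X : En n → En n} {Ω : Set (En n)}

lemma integral_wMeasure (hη : Continuous η) (f : En n → ℝ) :
    ∫ x, f x ∂(wMeasure η Ω) = ∫ x in Ω, Real.exp (-η x) * f x := by
  unfold wMeasure
  rw [integral_withDensity_eq_integral_toReal_smul (by fun_prop) (by simp)]
  simp [ENNReal.toReal_ofReal (Real.exp_nonneg _)]

lemma integrable_wMeasure (hη : Continuous η) (hΩb : Bornology.IsBounded Ω)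
    (hf : Continuous f) : Integrable f (wMeasure η Ω) := by
  unfold wMeasure
  rw [integrable_withDensity_iff_integrable_smul' (by fun_prop) (by simp)]
  simp only [ENNReal.toReal_ofReal (Real.exp_nonneg _), smul_eq_mul]
  have hc : Continuous fun x => Real.exp (-η x) * f x := by fun_prop
  exact (hc.continuousOn.integrableOn_compact hΩb.isCompact_closure).mono_set subset_closure

lemma ae_mem_wMeasure (hΩ : IsOpen Ω) : ∀ᵐ x ∂(wMeasure η Ω), x ∈ Ω :=
  (withDensity_absolutelyContinuous _ _).ae_le (ae_restrict_mem hΩ.measurableSet)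

lemma integral_vdivEta_eq_zero (hΩ : IsOpen Ω) (hΩb : Bornology.IsBounded Ω)
    (hη : ContDiff ℝ (⊤ : ℕ∞) η) (hX : ContDiff ℝ (⊤ : ℕ∞) X) (h0 : ∀ x ∈ frontier Ω, X x = 0) :
    ∫ x, vdivEta η X x ∂(wMeasure η Ω) = 0 := by
  have h1 : ((⊤ : ℕ∞) : WithTop ℕ∞) ≠ 0 := by simp
  have hE : ContDiff ℝ (⊤ : ℕ∞) fun x => Real.exp (-η x) := hη.neg.exp
  have hY : ContDiff ℝ (⊤ : ℕ∞) fun x => Real.exp (-η x) • X x := hE.smul hX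
  have hgrad : ∀ x, gradient (fun y => Real.exp (-η y)) x = -(Real.exp (-η x) • gradient η x) := by
    intro x
    refine ext_inner_right ℝ fun v => ?_
    have hd : HasFDerivAt (fun y => Real.exp (-η y)) (Real.exp (-η x) • -fderiv ℝ η x) x :=
      (hη.differentiable h1 x).hasFDerivAt.neg.exp
    rw [inner_gradient_left, hd.fderiv]
    simp [inner_smul_left, inner_gradient_left]
  rw [integral_wMeasure hη.continuous]
  have key : ∀ x, Real.exp (-η x) * vdivEta η X x
      = ∑ i, fderiv ℝ (fun y => (Real.exp (-η y) • X y) i) x (EuclideanSpace.single i 1) := by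
    intro x
    have h2 : vdiv (fun y => Real.exp (-η y) • X y) x = Real.exp (-η x) * vdivEta η X x := by
      rw [vdiv_smul x (hE.differentiable h1 x) (hX.differentiable h1 x), hgrad, inner_neg_left,
        inner_smul_left]
      simp only [vdivEta, conj_trivial]
      ring
    rw [← h2]
    exact Finset.sum_congr rfl fun i _ =>
      (fderiv_euclidean_apply (hY.differentiable h1) x _ i).symm
  simp only [key]
  rw [integral_finsetSum]
  · refine Finset.sum_eq_zero fun i _ => ?_
    refine setIntegral_fderiv_eq_zero_of_frontier_eq_zero volume hΩ hΩb
      ((hY.euclidean_apply i).of_le (by exact_mod_cast le_top)) (fun x hx => ?_) _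
    simp [h0 x hx]
  · intro i _
    have hc : Continuous fun x =>
        fderiv ℝ (fun y => (Real.exp (-η y) • X y) i) x (EuclideanSpace.single i 1) :=
      ((hY.euclidean_apply i).continuous_fderiv h1).clm_apply continuous_const
    exact (hc.continuousOn.integrableOn_compact hΩb.isCompact_closure).mono_set subset_closure

/-- Weighted integration by parts. -/
lemma integral_mul_vdivEta_add_inner_eq_zero (hΩ : IsOpen Ω) (hΩb : Bornology.IsBounded Ω)
    (hη : ContDiff ℝ (⊤ : ℕ∞) η) (hf : ContDiff ℝ (⊤ : ℕ∞) f) (hX : ContDiff ℝ (⊤ : ℕ∞) X)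
    (h0 : ∀ x ∈ frontier Ω, f x • X x = 0) :
    ∫ x, (f x * vdivEta η X x + ⟪gradient f x, X x⟫) ∂(wMeasure η Ω) = 0 := by
  have h1 : ((⊤ : ℕ∞) : WithTop ℕ∞) ≠ 0 := by simp
  rw [← integral_vdivEta_eq_zero hΩ hΩb hη (hf.smul hX) h0]
  refine integral_congr_ae (Filter.Eventually.of_forall fun x => ?_)
  exact (vdivEta_smul x (hf.differentiable h1 x) (hX.differentiable h1 x)).symm

end WeightedMeasure

section Energy

variable {n : ℕ} {η g : En n → ℝ} {T : En n → (En n →L[ℝ] En n)} {u : En n → En n}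
  {Ω : Set (En n)} {α σ ε δ : ℝ}

/-- The integrand `⟨T(∇w), ∇w⟩ + α (div_η w)²` of the quadratic form of `𝓛 + α ∇ div_η`. -/
def energyDensity {n : ℕ} (T : En n → (En n →L[ℝ] En n)) (η : En n → ℝ) (α : ℝ)
    (w : En n → En n) (x : En n) : ℝ :=
  (∑ l, ⟪T x (gradient (fun y => w y l) x), gradient (fun y => w y l) x⟫)
    + α * (vdivEta η w x) ^ 2

lemma norm_clm_sq_le_of_le {E : Type*} [NormedAddCommGroup E] [InnerProductSpace ℝ E]
    (A : E →L[ℝ] E) (hsym : ∀ v w, ⟪A v, w⟫ = ⟪v, A w⟫) (hδ : 0 < δ) (h0 : ∀ v, 0 ≤ ⟪A v, v⟫)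
    (h1 : ∀ v, ⟪A v, v⟫ ≤ δ * ‖v‖ ^ 2) (v : E) : ‖A v‖ ^ 2 ≤ δ * ⟪A v, v⟫ := by
  have h := h0 (δ • v - A v)
  simp only [map_sub, map_smul, inner_sub_left, inner_sub_right, inner_smul_left,
    inner_smul_right, conj_trivial] at h
  rw [hsym (A v) v, real_inner_self_eq_norm_sq] at h
  have h2 := h1 (A v)
  have : 0 ≤ δ * (δ * ⟪A v, v⟫ - ‖A v‖ ^ 2) := by nlinarith
  have := nonneg_of_mul_nonneg_right this hδ
  linarith

lemma energyDensity_smul (hTsym : ∀ x v w, ⟪T x v, w⟫ = ⟪v, T x w⟫) (hu : ContDiff ℝ (⊤ : ℕ∞) u)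
    (hg : ContDiff ℝ (⊤ : ℕ∞) g) (x : En n)
    (heig : ∀ l : Fin n, Lop T η (fun y => u y l) x + α * gradient (vdivEta η u) x l
      = -σ * u x l) :
    energyDensity T η α (fun y => g y • u y) x =
      σ * ((g x) ^ 2 * ‖u x‖ ^ 2) + ‖u x‖ ^ 2 * ⟪T x (gradient g x), gradient g x⟫
        + α * ⟪gradient g x, u x⟫ ^ 2
        + (∑ l, ((g x * g x * u x l) * Lop T η (fun y => u y l) x
            + ⟪gradient (fun y => g y * g y * u y l) x, T x (gradient (fun y => u y l) x)⟫))
        + α * (vdivEta η u x * vdivEta η (fun y => (g y * g y) • u y) x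
            + ⟪gradient (vdivEta η u) x, (g x * g x) • u x⟫) := by
  have h1 : ((⊤ : ℕ∞) : WithTop ℕ∞) ≠ 0 := by simp
  have hgd := hg.differentiable h1 x
  have hud := hu.differentiable h1 x
  have hul : ∀ l, DifferentiableAt ℝ (fun y => u y l) x := fun l =>
    (hu.euclidean_apply l).differentiable h1 x
  have hgg : DifferentiableAt ℝ (fun y => g y * g y) x := hgd.mul hgd
  unfold energyDensity
  rw [vdivEta_smul x hgd hud, vdivEta_smul x hgg hud, gradient_mul x hgd hgd]
  have hl : ∀ l, ⟪T x (gradient (fun y => (g y • u y) l) x), gradient (fun y => (g y • u y) l) x⟫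
      = (u x l) ^ 2 * ⟪T x (gradient g x), gradient g x⟫
        + ⟪gradient (fun y => g y * g y * u y l) x, T x (gradient (fun y => u y l) x)⟫ := by
    intro l
    have e1 : (fun y => (g y • u y) l) = fun y => g y * u y l := by ext y; simp
    rw [e1, gradient_mul x hgd (hul l), gradient_mul x hgg (hul l), gradient_mul x hgd hgd]
    simp only [map_add, map_smul, inner_add_left, inner_add_right, inner_smul_left,
      inner_smul_right, conj_trivial, hTsym]
    rw [real_inner_comm (T x (gradient g x)) (gradient (fun y => u y l) x), hTsym]
    ring
  have hsum : ∑ l, (g x * g x * u x l) * Lop T η (fun y => u y l) x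
      = -(σ * ((g x) ^ 2 * ‖u x‖ ^ 2)) - α * ((g x) ^ 2 * ⟪gradient (vdivEta η u) x, u x⟫) := by
    rw [← real_inner_self_eq_norm_sq, inner_eq_sum_mul, inner_eq_sum_mul]
    simp only [Finset.mul_sum]
    rw [← Finset.sum_neg_distrib, ← Finset.sum_sub_distrib]
    refine Finset.sum_congr rfl fun l _ => ?_
    rw [eq_sub_of_add_eq (heig l)]
    ring
  simp only [hl]
  rw [Finset.sum_add_distrib, Finset.sum_add_distrib, hsum, ← Finset.sum_mul,
    ← real_inner_self_eq_norm_sq (u x), inner_eq_sum_mul (u x) (u x)]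
  simp only [inner_add_left, inner_smul_left, inner_smul_right, conj_trivial, ← pow_two]
  ring

lemma integral_energyDensity_smul (hΩ : IsOpen Ω) (hΩb : Bornology.IsBounded Ω)
    (hη : ContDiff ℝ (⊤ : ℕ∞) η) (hT : ContDiff ℝ (⊤ : ℕ∞) T)
    (hTsym : ∀ x v w, ⟪T x v, w⟫ = ⟪v, T x w⟫) (hu : ContDiff ℝ (⊤ : ℕ∞) u)
    (hg : ContDiff ℝ (⊤ : ℕ∞) g) (hbd : ∀ x ∈ frontier Ω, u x = 0)
    (heig : ∀ x ∈ Ω, ∀ l : Fin n,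
      Lop T η (fun y => u y l) x + α * gradient (vdivEta η u) x l = -σ * u x l) :
    ∫ x, energyDensity T η α (fun y => g y • u y) x ∂(wMeasure η Ω) =
      σ * ∫ x, (g x) ^ 2 * ‖u x‖ ^ 2 ∂(wMeasure η Ω)
        + ∫ x, (‖u x‖ ^ 2 * ⟪T x (gradient g x), gradient g x⟫
          + α * ⟪gradient g x, u x⟫ ^ 2) ∂(wMeasure η Ω) := by
  have hgc := hg.continuous
  have huc := hu.continuous
  have hTc := hT.continuous
  have hgrad : ∀ {f : En n → ℝ}, ContDiff ℝ (⊤ : ℕ∞) f → Continuous (gradient f) :=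
    fun hf => (contDiff_gradient hf).continuous
  have hX : ∀ l, ContDiff ℝ (⊤ : ℕ∞) fun y => T y (gradient (fun z => u z l) y) := fun l =>
    hT.clm_apply (contDiff_gradient (hu.euclidean_apply l))
  have hf : ∀ l, ContDiff ℝ (⊤ : ℕ∞) fun y => g y * g y * u y l := fun l =>
    (hg.mul hg).mul (hu.euclidean_apply l)
  have hd := contDiff_vdivEta hη hu
  have hggu : ContDiff ℝ (⊤ : ℕ∞) fun y => (g y * g y) • u y := (hg.mul hg).smul hu
  have i1 : Integrable (fun x => σ * ((g x) ^ 2 * ‖u x‖ ^ 2)) (wMeasure η Ω) :=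
    integrable_wMeasure hη.continuous hΩb (by fun_prop)
  have i2 : Integrable (fun x => ‖u x‖ ^ 2 * ⟪T x (gradient g x), gradient g x⟫
      + α * ⟪gradient g x, u x⟫ ^ 2) (wMeasure η Ω) := by
    have := hgrad hg
    exact integrable_wMeasure hη.continuous hΩb (by fun_prop)
  have i3 : ∀ l, Integrable (fun x => (g x * g x * u x l) * Lop T η (fun y => u y l) x
      + ⟪gradient (fun y => g y * g y * u y l) x, T x (gradient (fun y => u y l) x)⟫)
      (wMeasure η Ω) := fun l =>
    integrable_wMeasure hη.continuous hΩb
      (((hf l).continuous.mul (contDiff_vdivEta hη (hX l)).continuous).add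
        ((hgrad (hf l)).inner (hX l).continuous))
  have i4 : Integrable (fun x => α * (vdivEta η u x * vdivEta η (fun y => (g y * g y) • u y) x
      + ⟪gradient (vdivEta η u) x, (g x * g x) • u x⟫)) (wMeasure η Ω) :=
    (integrable_wMeasure hη.continuous hΩb
      ((hd.continuous.mul (contDiff_vdivEta hη hggu).continuous).add
        ((hgrad hd).inner hggu.continuous))).const_mul α
  have i5 := integrable_finsetSum Finset.univ fun l _ => i3 l
  have z3 : ∀ l, ∫ x, ((g x * g x * u x l) * Lop T η (fun y => u y l) x
      + ⟪gradient (fun y => g y * g y * u y l) x, T x (gradient (fun y => u y l) x)⟫)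
      ∂(wMeasure η Ω) = 0 := fun l =>
    integral_mul_vdivEta_add_inner_eq_zero hΩ hΩb hη (hf l) (hX l)
      fun x hx => by simp [hbd x hx]
  have z4 : ∫ x, α * (vdivEta η u x * vdivEta η (fun y => (g y * g y) • u y) x
      + ⟪gradient (vdivEta η u) x, (g x * g x) • u x⟫) ∂(wMeasure η Ω) = 0 := by
    rw [integral_const_mul, integral_mul_vdivEta_add_inner_eq_zero hΩ hΩb hη hd hggu
      (fun x hx => by simp [hbd x hx]), mul_zero]
  have hpt : ∀ᵐ x ∂(wMeasure η Ω), energyDensity T η α (fun y => g y • u y) x =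
      σ * ((g x) ^ 2 * ‖u x‖ ^ 2) + (‖u x‖ ^ 2 * ⟪T x (gradient g x), gradient g x⟫
        + α * ⟪gradient g x, u x⟫ ^ 2)
        + (∑ l, ((g x * g x * u x l) * Lop T η (fun y => u y l) x
            + ⟪gradient (fun y => g y * g y * u y l) x, T x (gradient (fun y => u y l) x)⟫))
        + α * (vdivEta η u x * vdivEta η (fun y => (g y * g y) • u y) x
            + ⟪gradient (vdivEta η u) x, (g x * g x) • u x⟫) := by
    filter_upwards [ae_mem_wMeasure hΩ] with x hx
    rw [energyDensity_smul hTsym hu hg x (heig x hx)]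
    ring
  refine (integral_congr_ae hpt).trans ((integral_add' ((i1.add i2).add i5) i4).trans ?_)
  rw [integral_add' (i1.add i2) i5, integral_add' i1 i2, z4,
    integral_finsetSum _ (fun l _ => i3 l), integral_const_mul,
    Finset.sum_eq_zero (fun l _ => z3 l), add_zero, add_zero]

lemma two_mul_mul_le_of_ellipticity (hΩ : IsOpen Ω) (hΩb : Bornology.IsBounded Ω)
    (hη : ContDiff ℝ (⊤ : ℕ∞) η) (hT : ContDiff ℝ (⊤ : ℕ∞) T)
    (hTsym : ∀ x v w, ⟪T x v, w⟫ = ⟪v, T x w⟫) (hu : ContDiff ℝ (⊤ : ℕ∞) u)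
    (hbd : ∀ x ∈ frontier Ω, u x = 0) (hnorm : ∫ x, ‖u x‖ ^ 2 ∂(wMeasure η Ω) = 1)
    (hell : ∀ x v, ε * ‖v‖ ^ 2 ≤ ⟪T x v, v⟫) (e : En n) (he : ‖e‖ = 1) (a : ℝ)
    {t : ℝ} (ht : 0 ≤ t) :
    2 * ε * t ≤ t ^ 2 * ∫ x, (⟪e, x⟫ - a) ^ 2 * ‖u x‖ ^ 2 ∂(wMeasure η Ω)
      + ∫ x, ∑ l, ⟪e, (2 : ℝ) • T x (gradient (fun y => u y l) x)
          + u x l • (trGradT T x - T x (gradient η x))⟫ ^ 2 ∂(wMeasure η Ω) := by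
  have h1 : ((⊤ : ℕ∞) : WithTop ℕ∞) ≠ 0 := by simp
  have huc := hu.continuous
  have hTc := hT.continuous
  have hηg := (contDiff_gradient hη).continuous
  have hug : ∀ l, Continuous (gradient fun y => u y l) := fun l =>
    (contDiff_gradient (hu.euclidean_apply l)).continuous
  have htr := (contDiff_trGradT hT).continuous
  have hg : ContDiff ℝ (⊤ : ℕ∞) fun y : En n => ⟪e, y⟫ - a :=
    (contDiff_const.inner ℝ contDiff_id).sub contDiff_const
  have hN : ContDiff ℝ (⊤ : ℕ∞) fun y => ‖u y‖ ^ 2 := hu.norm_sq ℝ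
  have hTe : ContDiff ℝ (⊤ : ℕ∞) fun y => T y e := hT.clm_apply contDiff_const
  have hgN := hg.mul hN
  have hz := integral_mul_vdivEta_add_inner_eq_zero hΩ hΩb hη hgN hTe
    fun x hx => by simp [hbd x hx]
  have iz : Integrable (fun x => (⟪e, x⟫ - a) * ‖u x‖ ^ 2 * vdivEta η (fun y => T y e) x
      + ⟪gradient (fun y => (⟪e, y⟫ - a) * ‖u y‖ ^ 2) x, T x e⟫) (wMeasure η Ω) :=
    integrable_wMeasure hη.continuous hΩb
      ((hgN.continuous.mul (contDiff_vdivEta hη hTe).continuous).add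
        ((contDiff_gradient hgN).continuous.inner hTe.continuous))
  have i0 : Integrable (fun x => ‖u x‖ ^ 2) (wMeasure η Ω) :=
    integrable_wMeasure hη.continuous hΩb hN.continuous
  have i1 : Integrable (fun x => (⟪e, x⟫ - a) ^ 2 * ‖u x‖ ^ 2) (wMeasure η Ω) :=
    integrable_wMeasure hη.continuous hΩb (by fun_prop)
  have i2 : Integrable (fun x => ∑ l, ⟪e, (2 : ℝ) • T x (gradient (fun y => u y l) x)
      + u x l • (trGradT T x - T x (gradient η x))⟫ ^ 2) (wMeasure η Ω) := by
    refine integrable_wMeasure hη.continuous hΩb (continuous_finsetSum _ fun l _ => ?_)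
    have := hug l
    fun_prop
  have hpt : ∀ x, 2 * ε * t * ‖u x‖ ^ 2 - 2 * t *
      ((⟪e, x⟫ - a) * ‖u x‖ ^ 2 * vdivEta η (fun y => T y e) x
        + ⟪gradient (fun y => (⟪e, y⟫ - a) * ‖u y‖ ^ 2) x, T x e⟫)
      ≤ t ^ 2 * ((⟪e, x⟫ - a) ^ 2 * ‖u x‖ ^ 2)
        + ∑ l, ⟪e, (2 : ℝ) • T x (gradient (fun y => u y l) x)
          + u x l • (trGradT T x - T x (gradient η x))⟫ ^ 2 := by
    intro x
    rw [vdivEta_clm_apply_const (hT.differentiable h1) hTsym,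
      gradient_mul x (hg.differentiable h1 x) (hN.differentiable h1 x),
      gradient_inner_sub_const, gradient_sum_mul_self (hu.differentiable h1)]
    have hE := hell x e
    rw [he] at hE
    have hE' : ε * ‖u x‖ ^ 2 ≤ ‖u x‖ ^ 2 * ⟪e, T x e⟫ := by
      rw [← hTsym]
      nlinarith [sq_nonneg ‖u x‖]
    have hsq : 0 ≤ ∑ l, (t * ((⟪e, x⟫ - a) * u x l)
        + ⟪e, (2 : ℝ) • T x (gradient (fun y => u y l) x)
          + u x l • (trGradT T x - T x (gradient η x))⟫) ^ 2 :=
      Finset.sum_nonneg fun l _ => sq_nonneg _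
    have hexp : ∑ l, (t * ((⟪e, x⟫ - a) * u x l)
        + ⟪e, (2 : ℝ) • T x (gradient (fun y => u y l) x)
          + u x l • (trGradT T x - T x (gradient η x))⟫) ^ 2
        = t ^ 2 * ((⟪e, x⟫ - a) ^ 2 * ‖u x‖ ^ 2)
          + ∑ l, ⟪e, (2 : ℝ) • T x (gradient (fun y => u y l) x)
            + u x l • (trGradT T x - T x (gradient η x))⟫ ^ 2
          + 2 * t * ((⟪e, x⟫ - a) * ‖u x‖ ^ 2 * ⟪trGradT T x - T x (gradient η x), e⟫
            + (⟪e, x⟫ - a) * (2 * ∑ l, u x l * ⟪gradient (fun y => u y l) x, T x e⟫)) := by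
      rw [← real_inner_self_eq_norm_sq (u x), inner_eq_sum_mul (u x) (u x)]
      simp only [Finset.mul_sum, Finset.sum_mul, ← Finset.sum_add_distrib]
      refine Finset.sum_congr rfl fun l _ => ?_
      rw [← hTsym x (gradient (fun y => u y l) x) e, inner_add_right, inner_smul_right,
        inner_smul_right, real_inner_comm e, real_inner_comm e]
      ring
    rw [hexp] at hsq
    simp only [inner_add_left, inner_smul_left, sum_inner, conj_trivial]
    nlinarith [mul_le_mul_of_nonneg_left hE' ht]
  have hle := integral_mono ((i0.const_mul (2 * ε * t)).sub (iz.const_mul (2 * t)))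
    ((i1.const_mul (t ^ 2)).add i2) hpt
  rw [integral_sub' (i0.const_mul _) (iz.const_mul _), integral_add' (i1.const_mul _) i2,
    integral_const_mul, integral_const_mul, integral_const_mul, hz, hnorm] at hle
  linarith

lemma integral_sum_norm_sq_le {T₀ C₀ : ℝ} (hΩ : IsOpen Ω) (hΩb : Bornology.IsBounded Ω)
    (hη : ContDiff ℝ (⊤ : ℕ∞) η) (hT : ContDiff ℝ (⊤ : ℕ∞) T)
    (hTsym : ∀ x v w, ⟪T x v, w⟫ = ⟪v, T x w⟫) (hu : ContDiff ℝ (⊤ : ℕ∞) u)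
    (hbd : ∀ x ∈ frontier Ω, u x = 0) (hnorm : ∫ x, ‖u x‖ ^ 2 ∂(wMeasure η Ω) = 1)
    (hδ : 0 < δ) (h0 : ∀ x v, 0 ≤ ⟪T x v, v⟫) (hell : ∀ x v, ⟪T x v, v⟫ ≤ δ * ‖v‖ ^ 2)
    (hT₀ : ∀ x ∈ Ω, ‖trGradT T x‖ ≤ T₀)
    (hC₀ : ∀ x ∈ Ω, (1 / 2) * vdiv (fun y => T y (T y (gradient η y) - trGradT T y)) x
      - (1 / 4) * ‖T x (gradient η x)‖ ^ 2 ≤ C₀) :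
    ∫ x, ∑ l, ‖(2 : ℝ) • T x (gradient (fun y => u y l) x)
        + u x l • (trGradT T x - T x (gradient η x))‖ ^ 2 ∂(wMeasure η Ω)
      ≤ 4 * δ * ∫ x, ∑ l, ⟪T x (gradient (fun y => u y l) x), gradient (fun y => u y l) x⟫
          ∂(wMeasure η Ω) + (T₀ ^ 2 + 4 * C₀) := by
  have h1 : ((⊤ : ℕ∞) : WithTop ℕ∞) ≠ 0 := by simp
  have huc := hu.continuous
  have hTc := hT.continuous
  have hηg := (contDiff_gradient hη).continuous
  have hug : ∀ l, Continuous (gradient fun y => u y l) := fun l =>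
    (contDiff_gradient (hu.euclidean_apply l)).continuous
  have htr := (contDiff_trGradT hT).continuous
  have hN : ContDiff ℝ (⊤ : ℕ∞) fun y => ‖u y‖ ^ 2 := hu.norm_sq ℝ
  have hTV : ContDiff ℝ (⊤ : ℕ∞) fun y => T y (trGradT T y - T y (gradient η y)) :=
    hT.clm_apply ((contDiff_trGradT hT).sub (hT.clm_apply (contDiff_gradient hη)))
  have hz := integral_mul_vdivEta_add_inner_eq_zero hΩ hΩb hη hN hTV
    fun x hx => by simp [hbd x hx]
  have iz : Integrable (fun x => ‖u x‖ ^ 2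
        * vdivEta η (fun y => T y (trGradT T y - T y (gradient η y))) x
      + ⟪gradient (fun y => ‖u y‖ ^ 2) x, T x (trGradT T x - T x (gradient η x))⟫)
      (wMeasure η Ω) :=
    integrable_wMeasure hη.continuous hΩb
      ((hN.continuous.mul (contDiff_vdivEta hη hTV).continuous).add
        ((contDiff_gradient hN).continuous.inner hTV.continuous))
  have i0 : Integrable (fun x => ‖u x‖ ^ 2) (wMeasure η Ω) :=
    integrable_wMeasure hη.continuous hΩb hN.continuous
  have i1 : Integrable (fun x => ∑ l, ‖(2 : ℝ) • T x (gradient (fun y => u y l) x)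
      + u x l • (trGradT T x - T x (gradient η x))‖ ^ 2) (wMeasure η Ω) := by
    refine integrable_wMeasure hη.continuous hΩb (continuous_finsetSum _ fun l _ => ?_)
    have := hug l
    fun_prop
  have i2 : Integrable (fun x => ∑ l, ⟪T x (gradient (fun y => u y l) x),
      gradient (fun y => u y l) x⟫) (wMeasure η Ω) := by
    refine integrable_wMeasure hη.continuous hΩb (continuous_finsetSum _ fun l _ => ?_)
    have := hug l
    fun_prop
  have hpt : ∀ x ∈ Ω, ∑ l, ‖(2 : ℝ) • T x (gradient (fun y => u y l) x)
        + u x l • (trGradT T x - T x (gradient η x))‖ ^ 2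
      - 2 * (‖u x‖ ^ 2 * vdivEta η (fun y => T y (trGradT T y - T y (gradient η y))) x
        + ⟪gradient (fun y => ‖u y‖ ^ 2) x, T x (trGradT T x - T x (gradient η x))⟫)
      ≤ 4 * δ * ∑ l, ⟪T x (gradient (fun y => u y l) x), gradient (fun y => u y l) x⟫
        + (T₀ ^ 2 + 4 * C₀) * ‖u x‖ ^ 2 := by
    intro x hx
    have hneg : vdiv (fun y => T y (trGradT T y - T y (gradient η y))) x
        = -vdiv (fun y => T y (T y (gradient η y) - trGradT T y)) x := by
      rw [← vdiv_neg]
      congr 1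
      ext1 y
      rw [← map_neg, neg_sub]
    have hcoef : ‖trGradT T x - T x (gradient η x)‖ ^ 2
        - 2 * vdivEta η (fun y => T y (trGradT T y - T y (gradient η y))) x
        ≤ T₀ ^ 2 + 4 * C₀ := by
      have hA : ‖trGradT T x‖ ^ 2 ≤ T₀ ^ 2 := pow_le_pow_left₀ (norm_nonneg _) (hT₀ x hx) 2
      have hC := hC₀ x hx
      unfold vdivEta
      rw [hneg, norm_sub_sq_real, ← hTsym x (gradient η x), inner_sub_right,
        real_inner_self_eq_norm_sq, real_inner_comm (T x (gradient η x)) (trGradT T x)]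
      linarith
    have hsum : ∑ l, ‖(2 : ℝ) • T x (gradient (fun y => u y l) x)
        + u x l • (trGradT T x - T x (gradient η x))‖ ^ 2
        = 4 * ∑ l, ‖T x (gradient (fun y => u y l) x)‖ ^ 2
          + 2 * ⟪gradient (fun y => ‖u y‖ ^ 2) x, T x (trGradT T x - T x (gradient η x))⟫
          + ‖u x‖ ^ 2 * ‖trGradT T x - T x (gradient η x)‖ ^ 2 := by
      rw [gradient_sum_mul_self (hu.differentiable h1), inner_smul_left, sum_inner,
        ← real_inner_self_eq_norm_sq (u x), inner_eq_sum_mul (u x) (u x)]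
      simp only [Finset.mul_sum, Finset.sum_mul, ← Finset.sum_add_distrib]
      refine Finset.sum_congr rfl fun l _ => ?_
      rw [norm_add_sq_real, norm_smul, norm_smul, inner_smul_left, inner_smul_left,
        inner_smul_right, ← hTsym x (gradient (fun y => u y l) x), mul_pow, mul_pow,
        Real.norm_eq_abs (u x l), sq_abs]
      simp only [conj_trivial, Real.norm_ofNat]
      ring
    have hTn : ∑ l, ‖T x (gradient (fun y => u y l) x)‖ ^ 2
        ≤ δ * ∑ l, ⟪T x (gradient (fun y => u y l) x), gradient (fun y => u y l) x⟫ := by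
      rw [Finset.mul_sum]
      exact Finset.sum_le_sum fun l _ =>
        norm_clm_sq_le_of_le (T x) (hTsym x) hδ (h0 x) (hell x) _
    rw [hsum]
    nlinarith [mul_le_mul_of_nonneg_left hcoef (sq_nonneg ‖u x‖)]
  have hle := integral_mono_ae (i1.sub (iz.const_mul 2))
    ((i2.const_mul (4 * δ)).add (i0.const_mul (T₀ ^ 2 + 4 * C₀)))
    ((ae_mem_wMeasure hΩ).mono hpt)
  rw [integral_sub' i1 (iz.const_mul _), integral_add' (i2.const_mul _) (i0.const_mul _),
    integral_const_mul, integral_const_mul, integral_const_mul, hz, hnorm] at hle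
  linarith

lemma gap_mul_sq_le {σ' : ℝ} (hΩ : IsOpen Ω) (hΩb : Bornology.IsBounded Ω)
    (hη : ContDiff ℝ (⊤ : ℕ∞) η) (hT : ContDiff ℝ (⊤ : ℕ∞) T)
    (hTsym : ∀ x v w, ⟪T x v, w⟫ = ⟪v, T x w⟫) (hu : ContDiff ℝ (⊤ : ℕ∞) u)
    (hbd : ∀ x ∈ frontier Ω, u x = 0) (hnorm : ∫ x, ‖u x‖ ^ 2 ∂(wMeasure η Ω) = 1)
    (heig : ∀ x ∈ Ω, ∀ l : Fin n,
      Lop T η (fun y => u y l) x + α * gradient (vdivEta η u) x l = -σ * u x l)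
    (hε : 0 < ε) (hδ : 0 < δ) (hα : 0 ≤ α) (hσ : σ ≤ σ')
    (hell : ∀ x v, ε * ‖v‖ ^ 2 ≤ ⟪T x v, v⟫ ∧ ⟪T x v, v⟫ ≤ δ * ‖v‖ ^ 2)
    (e : En n) (he : ‖e‖ = 1) (a : ℝ)
    (hmin : σ' * ∫ x, ‖(⟪e, x⟫ - a) • u x‖ ^ 2 ∂(wMeasure η Ω)
      ≤ ∫ x, energyDensity T η α (fun y => (⟪e, y⟫ - a) • u y) x ∂(wMeasure η Ω)) :
    (σ' - σ) * ε ^ 2 ≤ (δ + α) *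
      ∫ x, ∑ l, ⟪e, (2 : ℝ) • T x (gradient (fun y => u y l) x)
          + u x l • (trGradT T x - T x (gradient η x))⟫ ^ 2 ∂(wMeasure η Ω) := by
  have huc := hu.continuous
  have hTc := hT.continuous
  have hg : ContDiff ℝ (⊤ : ℕ∞) fun y : En n => ⟪e, y⟫ - a :=
    (contDiff_const.inner ℝ contDiff_id).sub contDiff_const
  have hen := integral_energyDensity_smul hΩ hΩb hη hT hTsym hu hg hbd heig
  have hW : ∫ x, ‖(⟪e, x⟫ - a) • u x‖ ^ 2 ∂(wMeasure η Ω)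
      = ∫ x, (⟪e, x⟫ - a) ^ 2 * ‖u x‖ ^ 2 ∂(wMeasure η Ω) := by
    simp only [norm_smul, mul_pow, Real.norm_eq_abs, sq_abs]
  have hP : ∫ x, (‖u x‖ ^ 2 * ⟪T x (gradient (fun y => ⟪e, y⟫ - a) x),
      gradient (fun y => ⟪e, y⟫ - a) x⟫ + α * ⟪gradient (fun y => ⟪e, y⟫ - a) x, u x⟫ ^ 2)
      ∂(wMeasure η Ω) ≤ δ + α := by
    simp only [gradient_inner_sub_const]
    calc _ ≤ ∫ x, (δ + α) * ‖u x‖ ^ 2 ∂(wMeasure η Ω) := by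
          refine integral_mono (integrable_wMeasure hη.continuous hΩb (by fun_prop))
            (integrable_wMeasure hη.continuous hΩb (by fun_prop)) fun x => ?_
          have hE := (hell x e).2
          rw [he] at hE
          have hcs : ⟪e, u x⟫ ^ 2 ≤ ‖u x‖ ^ 2 := by
            have h := abs_real_inner_le_norm e (u x)
            rw [he, one_mul] at h
            rw [← sq_abs]
            exact pow_le_pow_left₀ (abs_nonneg _) h 2
          have h2 := mul_le_mul_of_nonneg_left hcs hα
          have h3 := mul_le_mul_of_nonneg_left hE (sq_nonneg ‖u x‖)
          simp only
          linarith
      _ = δ + α := by rw [integral_const_mul, hnorm, mul_one]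
  rw [hW, hen] at hmin
  have hk : 0 ≤ σ' - σ := sub_nonneg.2 hσ
  have hc : 0 < δ + α := by linarith
  have ht : 0 ≤ (σ' - σ) * ε / (δ + α) := by positivity
  have key := two_mul_mul_le_of_ellipticity hΩ hΩb hη hT hTsym hu hbd hnorm
    (fun x v => (hell x v).1) e he a ht
  generalize ∫ x, (⟪e, x⟫ - a) ^ 2 * ‖u x‖ ^ 2 ∂(wMeasure η Ω) = W at *
  generalize ∫ x, ∑ l, ⟪e, (2 : ℝ) • T x (gradient (fun y => u y l) x)
    + u x l • (trGradT T x - T x (gradient η x))⟫ ^ 2 ∂(wMeasure η Ω) = q at *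
  obtain ⟨t, ht_def⟩ : ∃ t, t = (σ' - σ) * ε / (δ + α) := ⟨_, rfl⟩
  rw [← ht_def] at ht key
  have htc : t * (δ + α) = (σ' - σ) * ε := by rw [ht_def]; field_simp
  have hkW : (σ' - σ) * W ≤ δ + α := by linarith
  have h4 : (δ + α) * (t ^ 2 * W) ≤ (δ + α) * (ε * t) := by
    calc (δ + α) * (t ^ 2 * W) = (t * ε) * ((σ' - σ) * W) := by linear_combination t * W * htc
      _ ≤ (t * ε) * (δ + α) := mul_le_mul_of_nonneg_left hkW (by positivity)
      _ = (δ + α) * (ε * t) := by ring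
  have h5 : (δ + α) * (2 * ε * t) ≤ (δ + α) * (t ^ 2 * W + q) :=
    mul_le_mul_of_nonneg_left key hc.le
  have h6 : (σ' - σ) * ε ^ 2 = (δ + α) * (ε * t) := by linear_combination -ε * htc
  rw [h6]
  linarith

end Energy

section MainEstimate

variable {n : ℕ} {Ω : Set (En n)} {η : En n → ℝ} {T : En n → (En n →L[ℝ] En n)}
  {u : En n → En n}

lemma exists_orthonormalBasis_inner_eq_zero (m : Fin n → En n) :
    ∃ b : OrthonormalBasis (Fin n) ℝ (En n),
      ∀ i j : Fin n, 0 < (j : ℕ) → j ≤ i → ⟪b i, m j⟫ = 0 := by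
  have h : Module.finrank ℝ (En n) = Fintype.card (Fin n) := by simp
  refine ⟨InnerProductSpace.gramSchmidtOrthonormalBasis h
    fun k => if hk : (k : ℕ) + 1 < n then m ⟨k + 1, hk⟩ else 0, fun i j hj hij => ?_⟩
  have hlt : (⟨j - 1, by omega⟩ : Fin n) < i := by
    rw [Fin.lt_def]
    have : (j : ℕ) ≤ i := hij
    simp only
    omega
  have key := InnerProductSpace.gramSchmidtOrthonormalBasis_inv_triangular h
    (fun k : Fin n => if hk : (k : ℕ) + 1 < n then m ⟨k + 1, hk⟩ else 0) hlt
  have hj1 : (j : ℕ) - 1 + 1 = j := by omega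
  simpa [hj1] using key

lemma integral_inner_mul_eq_inner (hΩb : Bornology.IsBounded Ω) (hη : Continuous η)
    {φ : En n → ℝ} (hφ : Continuous φ) (e : En n) :
    ∫ x, ⟪e, x⟫ * φ x ∂(wMeasure η Ω)
      = ⟪e, WithLp.toLp 2 fun l => ∫ x, x l * φ x ∂(wMeasure η Ω)⟫ := by
  rw [inner_eq_sum_mul]
  simp only [inner_eq_sum_mul, Finset.sum_mul, mul_assoc]
  rw [integral_finsetSum _ fun l _ =>
    (integrable_wMeasure hη hΩb (by fun_prop)).const_mul (e l)]
  simp only [integral_const_mul]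

lemma sum_integral_inner_sq (b : OrthonormalBasis (Fin n) ℝ (En n))
    (hΩb : Bornology.IsBounded Ω) (hη : Continuous η) {V : Fin n → En n → En n}
    (hV : ∀ l, Continuous (V l)) :
    ∑ i, ∫ x, ∑ l, ⟪b i, V l x⟫ ^ 2 ∂(wMeasure η Ω)
      = ∫ x, ∑ l, ‖V l x‖ ^ 2 ∂(wMeasure η Ω) := by
  have hVint : ∀ i, Integrable (fun x => ∑ l, ⟪b i, V l x⟫ ^ 2) (wMeasure η Ω) := fun i =>
    integrable_wMeasure hη hΩb
      (continuous_finsetSum _ fun l _ => (continuous_const.inner (hV l)).pow 2)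
  rw [← integral_finsetSum _ fun i _ => hVint i]
  congr 1
  ext1 x
  rw [Finset.sum_comm]
  exact Finset.sum_congr rfl fun l _ => b.sum_sq_inner_right (V l x)

lemma le_sSup_image_of_continuous (hΩb : Bornology.IsBounded Ω) {φ : En n → ℝ}
    (hφ : Continuous φ) {x : En n} (hx : x ∈ Ω) : φ x ≤ sSup (φ '' Ω) :=
  le_csSup ((hΩb.isCompact_closure.bddAbove_image hφ.continuousOn).mono
    (Set.image_mono subset_closure)) (Set.mem_image_of_mem φ hx)

lemma integral_sum_inner_gradient {α σ : ℝ} (hΩ : IsOpen Ω) (hΩb : Bornology.IsBounded Ω)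
    (hη : ContDiff ℝ (⊤ : ℕ∞) η) (hT : ContDiff ℝ (⊤ : ℕ∞) T)
    (hTsym : ∀ x v w, ⟪T x v, w⟫ = ⟪v, T x w⟫) (hu : ContDiff ℝ (⊤ : ℕ∞) u)
    (hbd : ∀ x ∈ frontier Ω, u x = 0) (hnorm : ∫ x, ‖u x‖ ^ 2 ∂(wMeasure η Ω) = 1)
    (heig : ∀ x ∈ Ω, ∀ l : Fin n,
      Lop T η (fun y => u y l) x + α * gradient (vdivEta η u) x l = -σ * u x l) :
    ∫ x, ∑ l, ⟪T x (gradient (fun y => u y l) x), gradient (fun y => u y l) x⟫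
        ∂(wMeasure η Ω)
      = σ - α * ∫ x, (vdivEta η u x) ^ 2 ∂(wMeasure η Ω) := by
  have hTc := hT.continuous
  have hug : ∀ l, Continuous (gradient fun y => u y l) := fun l =>
    (contDiff_gradient (hu.euclidean_apply l)).continuous
  have i1 : Integrable (fun x => ∑ l, ⟪T x (gradient (fun y => u y l) x),
      gradient (fun y => u y l) x⟫) (wMeasure η Ω) := by
    refine integrable_wMeasure hη.continuous hΩb (continuous_finsetSum _ fun l _ => ?_)
    have := hug l
    fun_prop
  have i2 : Integrable (fun x => (vdivEta η u x) ^ 2) (wMeasure η Ω) :=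
    integrable_wMeasure hη.continuous hΩb ((contDiff_vdivEta hη hu).continuous.pow 2)
  have hen := integral_energyDensity_smul hΩ hΩb hη hT hTsym hu
    (contDiff_const (c := (1 : ℝ))) hbd heig
  have hgrad : ∀ x : En n, gradient (fun _ : En n => (1 : ℝ)) x = 0 := fun x => by
    simp [gradient]
  simp only [one_smul, hgrad, one_pow, one_mul, inner_zero_right, inner_zero_left, mul_zero,
    hnorm, mul_one, ne_eq, OfNat.ofNat_ne_zero, not_false_eq_true, zero_pow, add_zero,
    integral_zero] at hen
  have hsplit := integral_add i1 (i2.const_mul α)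
  rw [integral_const_mul] at hsplit
  have hsplit' : ∫ x, energyDensity T η α u x ∂(wMeasure η Ω) = _ := hsplit
  have hen' : ∫ x, energyDensity T η α u x ∂(wMeasure η Ω) = σ := hen
  linarith

end MainEstimate

/-- Theorem 1.2: estimate for the sum of lower order eigenvalues of the coupled
system `𝓛 u + α ∇(div_η u) = −σ u` on a bounded domain `Ω ⊂ ℝⁿ` in terms of the
first eigenvalue and its eigenfunction. -/
theorem lower_order_eigenvalues_estimate_second_order_system
    (n : ℕ) (hn : 0 < n)
    (Ω : Set (En n)) (hΩopen : IsOpen Ω) (hΩbd : Bornology.IsBounded Ω)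
    (hΩconn : IsConnected Ω)
    (η : En n → ℝ) (hη : ContDiff ℝ (⊤ : ℕ∞) η)
    (T : En n → (En n →L[ℝ] En n)) (hT : ContDiff ℝ (⊤ : ℕ∞) T)
    (hTsym : ∀ x v w, ⟪T x v, w⟫ = ⟪v, T x w⟫)
    (ε δ : ℝ) (hε : 0 < ε) (hεδ : ε ≤ δ)
    (hell : ∀ x v, ε * ‖v‖ ^ 2 ≤ ⟪T x v, v⟫ ∧ ⟪T x v, v⟫ ≤ δ * ‖v‖ ^ 2)
    (T₀ C₀ : ℝ)
    (hT₀ : T₀ = sSup ((fun x => ‖trGradT T x‖) '' Ω))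
    (hC₀ : C₀ = sSup ((fun x =>
        (1 / 2) * vdiv (fun y => T y (T y (gradient η y) - trGradT T y)) x
          - (1 / 4) * ‖T x (gradient η x)‖ ^ 2) '' Ω))
    (α : ℝ) (hα : 0 ≤ α)
    (σ : Fin (n + 1) → ℝ) (hσ : Monotone σ)
    (u : Fin n → En n → En n) (hu : ∀ i, ContDiff ℝ (⊤ : ℕ∞) (u i))
    (hbd : ∀ i, ∀ x ∈ frontier Ω, u i x = 0)
    (horth : ∀ i j, ∫ x, ⟪u i x, u j x⟫ ∂(wMeasure η Ω) = if i = j then 1 else 0)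
    (heig : ∀ (i : Fin n), ∀ x ∈ Ω, ∀ l : Fin n,
      Lop T η (fun y => u i y l) x + α * gradient (vdivEta η (u i)) x l
        = -(σ i.castSucc) * u i x l)
    (hmm : ∀ i : Fin n, ∀ w : En n → En n, ContDiff ℝ (⊤ : ℕ∞) w →
      (∀ x ∈ frontier Ω, w x = 0) →
      (∀ j : Fin n, j ≤ i → ∫ x, ⟪w x, u j x⟫ ∂(wMeasure η Ω) = 0) →
      σ i.succ * ∫ x, ‖w x‖ ^ 2 ∂(wMeasure η Ω) ≤
        ∫ x, ((∑ l, ⟪T x (gradient (fun y => w y l) x), gradient (fun y => w y l) x⟫)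
          + α * (vdivEta η w x) ^ 2) ∂(wMeasure η Ω)) :
    ∑ i : Fin n, (σ i.succ - σ 0) ≤
      (4 * δ * (δ + α) / ε ^ 2) *
        (σ 0 - α * (∫ x, (vdivEta η (u ⟨0, hn⟩) x) ^ 2 ∂(wMeasure η Ω))
          + (T₀ ^ 2 + 4 * C₀) / (4 * δ)) := by
  have hδ : 0 < δ := hε.trans_le hεδ
  set u₀ := u ⟨0, hn⟩ with hu₀
  have h0 : (⟨0, hn⟩ : Fin n).castSucc = 0 := rfl
  have huc : ∀ i, Continuous (u i) := fun i => (hu i).continuous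
  have hTc := hT.continuous
  have hu₀s : ContDiff ℝ (⊤ : ℕ∞) u₀ := hu _
  have hnorm : ∫ x, ‖u₀ x‖ ^ 2 ∂(wMeasure η Ω) = 1 := by
    simpa only [real_inner_self_eq_norm_sq, if_true] using horth ⟨0, hn⟩ ⟨0, hn⟩
  have heig₀ : ∀ x ∈ Ω, ∀ l : Fin n, Lop T η (fun y => u₀ y l) x
      + α * gradient (vdivEta η u₀) x l = -(σ 0) * u₀ x l := heig ⟨0, hn⟩
  have hbd₀ : ∀ x ∈ frontier Ω, u₀ x = 0 := hbd _
  obtain ⟨b, hb⟩ := exists_orthonormalBasis_inner_eq_zero fun j : Fin n =>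
    (WithLp.toLp 2 fun l => ∫ x, x l * ⟪u₀ x, u j x⟫ ∂(wMeasure η Ω) : En n)
  have hphi : ∀ j, Continuous fun x => ⟪u₀ x, u j x⟫ := fun j => (huc _).inner (huc j)
  have horth_test : ∀ i j : Fin n, j ≤ i →
      ∫ x, ⟪(⟪b i, x⟫ - ∫ y, ⟪b i, y⟫ * ⟪u₀ y, u₀ y⟫ ∂(wMeasure η Ω)) • u₀ x, u j x⟫
        ∂(wMeasure η Ω) = 0 := by
    intro i j hji
    have hphij := hphi j
    have i1 : Integrable (fun x => ⟪b i, x⟫ * ⟪u₀ x, u j x⟫) (wMeasure η Ω) :=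
      integrable_wMeasure hη.continuous hΩbd (by fun_prop)
    have i2 : Integrable (fun x => ⟪u₀ x, u j x⟫) (wMeasure η Ω) :=
      integrable_wMeasure hη.continuous hΩbd hphij
    simp only [real_inner_smul_left, sub_mul]
    rw [integral_sub i1 (i2.const_mul _), integral_const_mul, hu₀, horth]
    rcases Nat.eq_zero_or_pos (j : ℕ) with hj | hj
    · have hj0 : j = ⟨0, hn⟩ := Fin.ext hj
      subst hj0
      simp
    · have hj0 : (⟨0, hn⟩ : Fin n) ≠ j := fun h => by simp [← h] at hj
      rw [if_neg hj0, mul_zero, sub_zero,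
        integral_inner_mul_eq_inner hΩbd hη.continuous (hphi j)]
      exact hb i j hj hji
  have hgap : ∀ i : Fin n, (σ i.succ - σ 0) * ε ^ 2 ≤ (δ + α) *
      ∫ x, ∑ l, ⟪b i, (2 : ℝ) • T x (gradient (fun y => u₀ y l) x)
          + u₀ x l • (trGradT T x - T x (gradient η x))⟫ ^ 2 ∂(wMeasure η Ω) := fun i =>
    gap_mul_sq_le hΩopen hΩbd hη hT hTsym hu₀s hbd₀ hnorm heig₀ hε hδ hα (hσ (Fin.zero_le _))
      hell (b i) (b.norm_eq_one i) _
      (hmm i _ (((contDiff_const.inner ℝ contDiff_id).sub contDiff_const).smul hu₀s)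
        (fun x hx => by simp [hbd₀ x hx]) (horth_test i))
  have hVc : ∀ l : Fin n, Continuous fun x => (2 : ℝ) • T x (gradient (fun y => u₀ y l) x)
      + u₀ x l • (trGradT T x - T x (gradient η x)) := by
    intro l
    have h1 := (contDiff_gradient (hu₀s.euclidean_apply l)).continuous
    have h2 := (contDiff_gradient hη).continuous
    have h3 := (contDiff_trGradT hT).continuous
    have h4 := hu₀s.continuous
    fun_prop
  have hsum : (∑ i : Fin n, (σ i.succ - σ 0)) * ε ^ 2 ≤ (δ + α) *
      ∫ x, ∑ l, ‖(2 : ℝ) • T x (gradient (fun y => u₀ y l) x)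
        + u₀ x l • (trGradT T x - T x (gradient η x))‖ ^ 2 ∂(wMeasure η Ω) := by
    rw [← sum_integral_inner_sq b hΩbd hη.continuous hVc, Finset.mul_sum, Finset.sum_mul]
    exact Finset.sum_le_sum fun i _ => hgap i
  have htr : ContDiff ℝ (⊤ : ℕ∞) (trGradT T) := contDiff_trGradT hT
  have hTη : ContDiff ℝ (⊤ : ℕ∞) fun y => T y (gradient η y) :=
    hT.clm_apply (contDiff_gradient hη)
  have hT₀_le : ∀ x ∈ Ω, ‖trGradT T x‖ ≤ T₀ := fun x hx =>
    hT₀ ▸ le_sSup_image_of_continuous hΩbd htr.continuous.norm hx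
  have hC₀_le : ∀ x ∈ Ω, (1 / 2) * vdiv (fun y => T y (T y (gradient η y) - trGradT T y)) x
      - (1 / 4) * ‖T x (gradient η x)‖ ^ 2 ≤ C₀ := fun x hx =>
    hC₀ ▸ le_sSup_image_of_continuous hΩbd
      ((continuous_const.mul (contDiff_vdiv (hT.clm_apply (hTη.sub htr))).continuous).sub
        (continuous_const.mul (hTη.continuous.norm.pow 2))) hx
  have hS := integral_sum_norm_sq_le hΩopen hΩbd hη hT hTsym hu₀s hbd₀ hnorm hδ
    (fun x v => (mul_nonneg hε.le (sq_nonneg _)).trans (hell x v).1)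
    (fun x v => (hell x v).2) hT₀_le hC₀_le
  rw [integral_sum_inner_gradient hΩopen hΩbd hη hT hTsym hu₀s hbd₀ hnorm heig₀] at hS
  have hfinal := hsum.trans (mul_le_mul_of_nonneg_left hS (by linarith : 0 ≤ δ + α))
  rw [← le_div_iff₀ (by positivity)] at hfinal
  refine hfinal.trans_eq ?_
  field_simp

end
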